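/- arXiv:1812.09632 — 3 statements merged into one kernel-verified Lean document; each statement's English description precedes it below -/
import Mathlib

section
/- Let 0 < q < m be integers and n ≥ 1. Let 𝒢 be a finite group (under composition) of measurable bijections of ℝⁿ containing the identity G_0. Let x be a random element of a measurable space 𝒳 and ε an ℝⁿ-valued random vector independent of x such that G(ε) has the same distribution as ε for every G ∈ 𝒢. Let y* and α* be measurable functions of x with values in ℝⁿ, let K : 𝒳 → ℝ^{n×n} be measurable with K(x)α* = y*, and set y = y* + ε. Let ḡ : 𝒳 × ℝⁿ × ℝⁿ → ℝⁿ and Ψ : 𝒳 → ℝ^{n×n} be measurable. Let G_1,…,G_{m−1} be i.i.d. uniformly distributed on 𝒢, independent of (x, ε), and let π be a uniformly distributed random permutation of {0,…,m−1}, independent of everything else. Define Z_i(α) = ‖Ψ(x) ḡ(x, α, G_i(y − K(x)α))‖² for i = 0,…,m−1, define the strict total order ≺_π on indexed reals by Z_k ≺_π Z_j iff Z_k < Z_j, or Z_k = Z_j and π(k) < π(j), and define the normalized rank R(α) = (1/m)(1 + #{ i ∈ {1,…,m−1} : Z_0(α) ≺_π Z_i(α) }). Then P( R(α*) ≤ 1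 − q/m ) = 1 − q/m. -/
open MeasureTheory ProbabilityTheory Matrix

/-- The number of indices strictly above `k` when the values `w` are ordered with ties broken
by the permutation `σ`. -/
noncomputable def countAbove {m : ℕ} (w : Fin m → ℝ) (σ : Equiv.Perm (Fin m)) (k : Fin m) : ℕ :=
  (Finset.univ.filter fun i => w k < w i ∨ (w k = w i ∧ σ k < σ i)).card

theorem card_filter_card_lt {ι L : Type*} [Fintype ι] [LinearOrder L] {f : ι → L}
    (hf : Function.Injective f) {r : ℕ} (hr : r ≤ Fintype.card ι) :
    (Finset.univ.filter fun k => (Finset.univ.filter fun i => f k < f i).card < r).card = r := by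
  classical
  set N : ι → ℕ := fun k => (Finset.univ.filter fun i => f k < f i).card with hN
  have hlt : ∀ k, N k < Fintype.card ι := fun k =>
    Finset.card_lt_univ_of_notMem (x := k) (by simp)
  have hanti : ∀ a b, f a < f b → N b < N a := fun a b hab =>
    Finset.card_lt_card <| by
      refine Finset.ssubset_iff_of_subset (fun i => ?_) |>.2 ⟨b, by simpa using hab, by simp⟩
      simpa using hab.trans
  have hinj : Function.Injective N := fun a b hab => by
    rcases lt_trichotomy (f a) (f b) with h | h | h
    · exact absurd hab (hanti a b h).ne'
    · exact hf h
    · exact absurd hab (hanti b a h).ne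
  have himage : Finset.univ.image N = Finset.range (Fintype.card ι) := by
    refine Finset.eq_of_subset_of_card_le (fun j => ?_) ?_
    · simp only [Finset.mem_image, Finset.mem_univ, true_and, Finset.mem_range]
      rintro ⟨k, rfl⟩
      exact hlt k
    · rw [Finset.card_image_of_injective _ hinj, Finset.card_range, Finset.card_univ]
  rw [← Finset.card_image_of_injective _ hinj, ← Finset.filter_image (p := (· < r)), himage]
  have : (Finset.range (Fintype.card ι)).filter (· < r) = Finset.range r := by
    ext j
    simp only [Finset.mem_filter, Finset.mem_range]
    omega
  rw [this, Finset.card_range]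

theorem card_filter_countAbove_lt {m : ℕ} (w : Fin m → ℝ) (σ : Equiv.Perm (Fin m))
    {r : ℕ} (hr : r ≤ m) :
    (Finset.univ.filter fun k => countAbove w σ k < r).card = r := by
  have hf : Function.Injective fun i => toLex (w i, σ i) := fun a b hab =>
    σ.injective (congrArg (fun p => (ofLex p).2) hab)
  have h := card_filter_card_lt hf (r := r) (by simpa using hr)
  simp only [Prod.Lex.toLex_lt_toLex] at h
  unfold countAbove
  convert h

theorem countAbove_comp {m : ℕ} (w : Fin m → ℝ) (σ τ : Equiv.Perm (Fin m)) (k : Fin m) :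
    countAbove (w ∘ τ) (σ * τ) k = countAbove w σ (τ k) := by
  unfold countAbove
  refine Finset.card_equiv τ fun i => ?_
  rw [Finset.mem_filter, Finset.mem_filter]
  simp

theorem measurable_countAbove {m : ℕ} {S : Type*} [MeasurableSpace S] {w : S → Fin m → ℝ}
    (hw : ∀ i, Measurable fun s => w s i) (σ : Equiv.Perm (Fin m)) (k : Fin m) :
    Measurable fun s => countAbove (w s) σ k := by
  simp only [countAbove, Finset.card_filter]
  refine Finset.measurable_fun_sum _ fun i _ => Measurable.ite ?_ measurable_const measurable_const
  exact (measurableSet_lt (hw k) (hw i)).union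
    ((measurableSet_eq_fun (hw k) (hw i)).inter (MeasurableSet.const _))

theorem sum_measureReal_countAbove_lt {m : ℕ} {S : Type*} [MeasurableSpace S] (μ : Measure S)
    [IsProbabilityMeasure μ] {w : S → Fin m → ℝ} (hw : ∀ i, Measurable fun s => w s i)
    (σ : Equiv.Perm (Fin m)) {r : ℕ} (hr : r ≤ m) :
    ∑ k, μ.real {s | countAbove (w s) σ k < r} = r := by
  have hmeas : ∀ k, MeasurableSet {s | countAbove (w s) σ k < r} := fun k =>
    measurableSet_lt (measurable_countAbove hw σ k) measurable_const
  calc ∑ k, μ.real {s | countAbove (w s) σ k < r}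
      = ∑ k, ∫ s, {s | countAbove (w s) σ k < r}.indicator 1 s ∂μ := by
        simp only [integral_indicator_one (hmeas _)]
    _ = ∫ s, ∑ k, {s | countAbove (w s) σ k < r}.indicator (1 : S → ℝ) s ∂μ :=
        (integral_finsetSum _ fun k _ =>
          (integrable_indicator_iff (hmeas k)).2 (integrable_const (1 : ℝ)).integrableOn).symm
    _ = ∫ _, (r : ℝ) ∂μ := by
        congr 1 with s
        simp [Set.indicator_apply, card_filter_countAbove_lt (w s) σ hr]
    _ = r := by simp

/-- Averaging over the tuples with first entry `1` agrees with averaging over all tuples, for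
functions invariant under simultaneous right translation. -/
theorem card_mul_sum_eq_of_mul_right_invariant {ι G : Type*} [Fintype ι] [DecidableEq ι]
    [Group G] [Fintype G] [DecidableEq G] (k : ι) (f : (ι → G) → ℝ)
    (hf : ∀ h c, f (fun i => h i * c) = f h) :
    (Fintype.card G : ℝ) * ∑ h, (if h k = 1 then f h else 0) = ∑ h, f h := by
  calc (Fintype.card G : ℝ) * ∑ h, (if h k = 1 then f h else 0)
      = ∑ _c : G, ∑ h, (if h k = 1 then f h else 0) := by simp
    _ = ∑ c : G, ∑ h, (if h k * c = 1 then f h else 0) := by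
        refine Finset.sum_congr rfl fun c _ => ?_
        rw [← Equiv.sum_comp (Equiv.mulRight fun _ : ι => c)]
        refine Finset.sum_congr rfl fun h _ => ?_
        have hc : f (h * fun _ => c) = f h := hf h c
        simp [hc]
    _ = ∑ h, f h := by
        rw [Finset.sum_comm]
        refine Finset.sum_congr rfl fun h _ => ?_
        simp [mul_eq_one_iff_inv_eq]

theorem mul_sum_perm_eq_of_sum_eq {m : ℕ} {G : Type*} [Fintype G]
    (a : Fin m → (Fin m → G) → Equiv.Perm (Fin m) → ℝ) (k₀ : Fin m) (r : ℝ)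
    (hperm : ∀ k h σ (τ : Equiv.Perm (Fin m)), a k (h ∘ τ) (σ * τ) = a (τ k) h σ)
    (hsum : ∀ h σ, ∑ k, a k h σ = r) :
    (m : ℝ) * ∑ h, ∑ σ, a k₀ h σ = (Fintype.card G : ℝ) ^ m * m.factorial * r := by
  calc (m : ℝ) * ∑ h, ∑ σ, a k₀ h σ
      = ∑ _k : Fin m, ∑ h, ∑ σ, a k₀ h σ := by simp
    _ = ∑ k, ∑ h, ∑ σ, a k h σ := by
        refine Finset.sum_congr rfl fun k _ => ?_
        rw [← Equiv.sum_comp (Equiv.arrowCongr (Equiv.swap k₀ k) (Equiv.refl G))]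
        refine Finset.sum_congr rfl fun h _ => ?_
        rw [← Equiv.sum_comp (Equiv.mulRight (Equiv.swap k₀ k))]
        refine Finset.sum_congr rfl fun σ _ => ?_
        have := hperm k₀ h σ (Equiv.swap k₀ k)
        rw [Equiv.swap_apply_left] at this
        rw [← this]
        rfl
    _ = ∑ h, ∑ σ, ∑ k, a k h σ := by
        rw [Finset.sum_comm]
        exact Finset.sum_congr rfl fun h _ => Finset.sum_comm
    _ = _ := by simp [hsum, Fintype.card_perm, mul_assoc]

theorem real_pi_dirac_uniform_prod_uniform_singleton {m : ℕ} [NeZero m] {G : Type*} [Group G]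
    [Fintype G] [DecidableEq G] [MeasurableSpace G] [MeasurableSingletonClass G]
    [MeasurableSpace (Equiv.Perm (Fin m))] [MeasurableSingletonClass (Equiv.Perm (Fin m))]
    (t : (Fin m → G) × Equiv.Perm (Fin m)) :
    ((Measure.pi (fun i : Fin m =>
          if i = 0 then Measure.dirac (1 : G)
          else (PMF.uniformOfFintype G).toMeasure)).prod
        (PMF.uniformOfFintype (Equiv.Perm (Fin m))).toMeasure).real {t} =
      (if t.1 0 = 1 then 1 else 0) *
        (((Fintype.card G : ℝ) ^ (m - 1))⁻¹ * (m.factorial : ℝ)⁻¹) := by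
  have hprob : ∀ i : Fin m, IsProbabilityMeasure
      (if i = 0 then Measure.dirac (1 : G) else (PMF.uniformOfFintype G).toMeasure) := by
    intro i
    split_ifs <;> infer_instance
  obtain ⟨h, σ⟩ := t
  rw [← Set.singleton_prod_singleton, measureReal_prod_prod, ← Set.univ_pi_singleton,
    measureReal_def, Measure.pi_pi, ENNReal.toReal_prod,
    ← Finset.mul_prod_erase _ _ (Finset.mem_univ 0)]
  have hrest : ∀ i ∈ Finset.univ.erase (0 : Fin m),
      ((if i = 0 then Measure.dirac (1 : G) else (PMF.uniformOfFintype G).toMeasure)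
        {h i}).toReal = (Fintype.card G : ℝ)⁻¹ := by
    intro i hi
    rw [if_neg (Finset.ne_of_mem_erase hi), PMF.toMeasure_apply_singleton _ _ (.singleton _)]
    simp
  rw [Finset.prod_congr rfl hrest, measureReal_def,
    PMF.toMeasure_apply_singleton _ _ (.singleton _)]
  by_cases h0 : h 0 = 1
  · simp [h0, Fintype.card_perm]
  · simp [h0, Ne.symm h0, Set.indicator]

theorem measureReal_map_prodMk_eq_sum {Ω S T : Type*} [MeasurableSpace Ω] [MeasurableSpace S]
    [Fintype T] [MeasurableSpace T] [MeasurableSingletonClass T]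
    {P : Measure Ω} [IsProbabilityMeasure P] {X : Ω → S} {Y : Ω → T}
    (hX : Measurable X) (hY : Measurable Y) (hXY : IndepFun X Y P) {A : T → Set S}
    (hA : ∀ t, MeasurableSet (A t)) :
    P.real {ω | X ω ∈ A (Y ω)} = ∑ t, (P.map Y).real {t} * (P.map X).real (A t) := by
  have hset : ∀ t, {ω | X ω ∈ A (Y ω)} ∩ Y ⁻¹' {t} = Y ⁻¹' {t} ∩ X ⁻¹' A t := by
    intro t
    ext ω
    simp only [Set.mem_inter_iff, Set.mem_ofPred_eq, Set.mem_preimage, Set.mem_singleton_iff]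
    constructor
    · rintro ⟨h, rfl⟩
      exact ⟨rfl, h⟩
    · rintro ⟨rfl, h⟩
      exact ⟨h, rfl⟩
  have hsplit : {ω | X ω ∈ A (Y ω)} = ⋃ t, Y ⁻¹' {t} ∩ X ⁻¹' A t := by
    ext ω
    simp
  rw [hsplit, measureReal_iUnion_fintype]
  · refine Finset.sum_congr rfl fun t _ => ?_
    rw [map_measureReal_apply hY (.singleton t), map_measureReal_apply hX (hA t),
      measureReal_def, Set.inter_comm,
      hXY.measure_inter_preimage_eq_mul _ _ (hA t) (.singleton t), ENNReal.toReal_mul, mul_comm]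
    rfl
  · intro s t hst
    exact Set.disjoint_left.2 fun ω hs ht => hst (hs.1.symm.trans ht.1)
  · exact fun t => (hY (.singleton t)).inter (hX (hA t))

theorem map_prod_smul_eq {G 𝒳 V Ω : Type*} [SMul G V] [MeasurableSpace 𝒳] [MeasurableSpace V]
    [MeasurableSpace Ω] {P : Measure Ω} [IsProbabilityMeasure P] {x : Ω → 𝒳} {ε : Ω → V}
    (hx : Measurable x) (hε : Measurable ε) (hxε : IndepFun x ε P) (c : G)
    (hc : Measurable fun v : V => c • v)
    (hinv : P.map (fun ω => c • ε ω) = P.map ε) :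
    (P.map fun ω => (x ω, ε ω)).map (fun p => (p.1, c • p.2)) = P.map fun ω => (x ω, ε ω) := by
  have hcε : Measurable fun ω => c • ε ω := hc.comp hε
  have hindep : IndepFun x (fun ω => c • ε ω) P := hxε.comp measurable_id hc
  have hT : Measurable fun p : 𝒳 × V => (p.1, c • p.2) :=
    measurable_fst.prodMk (hc.comp measurable_snd)
  rw [Measure.map_map hT (hx.prodMk hε),
    (indepFun_iff_map_prod_eq_prod_map_map hx.aemeasurable hε.aemeasurable).1 hxε, ← hinv]
  exact (indepFun_iff_map_prod_eq_prod_map_map hx.aemeasurable hcε.aemeasurable).1 hindep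

/-- Exact distribution of the tie-broken rank of the reference score among randomly transformed
scores. -/
theorem measureReal_countAbove_smul_lt {m : ℕ} [NeZero m] {G 𝒳 V Ω : Type*} [Group G] [Fintype G]
    [MeasurableSpace G] [MeasurableSingletonClass G] [MulAction G V] [MeasurableSpace 𝒳]
    [MeasurableSpace V] [MeasurableSpace Ω] {P : Measure Ω} [IsProbabilityMeasure P]
    (hact : ∀ c : G, Measurable fun v : V => c • v) {x : Ω → 𝒳} {ε : Ω → V}
    (hx : Measurable x) (hε : Measurable ε) (hxε : IndepFun x ε P)
    (hinv : ∀ c : G, P.map (fun ω => c • ε ω) = P.map ε)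
    [MeasurableSpace (Equiv.Perm (Fin m))] [MeasurableSingletonClass (Equiv.Perm (Fin m))]
    {g : Ω → Fin m → G} (hg : Measurable g) {π : Ω → Equiv.Perm (Fin m)} (hπ : Measurable π)
    (hlaw : Measure.map (fun ω => (g ω, π ω)) P
      = (Measure.pi (fun i : Fin m =>
          if i = 0 then Measure.dirac (1 : G)
          else (PMF.uniformOfFintype G).toMeasure)).prod
        (PMF.uniformOfFintype (Equiv.Perm (Fin m))).toMeasure)
    (hindep : IndepFun (fun ω => (x ω, ε ω)) (fun ω => (g ω, π ω)) P)
    {F : 𝒳 × V → ℝ} (hF : Measurable F) {r : ℕ} (hr : r ≤ m) :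
    P.real {ω | countAbove (fun i => F (x ω, g ω i • ε ω)) (π ω) 0 < r} = (r : ℝ) / m := by
  classical
  set μ := P.map fun ω => (x ω, ε ω) with hμ
  have : IsProbabilityMeasure μ := Measure.isProbabilityMeasure_map (hx.prodMk hε).aemeasurable
  let w : (Fin m → G) → 𝒳 × V → Fin m → ℝ := fun h p i => F (p.1, h i • p.2)
  have hw : ∀ h i, Measurable fun p => w h p i := fun h i =>
    hF.comp (measurable_fst.prodMk ((hact (h i)).comp measurable_snd))
  have hA : ∀ k h σ, MeasurableSet {p | countAbove (w h p) σ k < r} := fun k h σ =>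
    measurableSet_lt (measurable_countAbove (hw h) σ k) measurable_const
  let a : Fin m → (Fin m → G) → Equiv.Perm (Fin m) → ℝ := fun k h σ =>
    μ.real {p | countAbove (w h p) σ k < r}
  have htrans : ∀ k h σ c, a k (fun i => h i * c) σ = a k h σ := by
    intro k h σ c
    have hmap := map_prod_smul_eq hx hε hxε c (hact c) (hinv c)
    rw [← hμ] at hmap
    have hT : Measurable fun p : 𝒳 × V => (p.1, c • p.2) :=
      measurable_fst.prodMk ((hact c).comp measurable_snd)
    change _ = μ.real _
    rw [← hmap, map_measureReal_apply hT (hA k h σ)]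
    simp [a, w, mul_smul]
  have hperm : ∀ k h σ (τ : Equiv.Perm (Fin m)), a k (h ∘ τ) (σ * τ) = a (τ k) h σ := by
    intro k h σ τ
    change μ.real _ = μ.real _
    congr 1
    ext p
    exact iff_of_eq (congrArg (· < r) (countAbove_comp (w h p) σ τ k))
  have htotal := mul_sum_perm_eq_of_sum_eq a 0 r hperm
    fun h σ => sum_measureReal_countAbove_lt μ (hw h) σ hr
  rw [← card_mul_sum_eq_of_mul_right_invariant 0 (fun h => ∑ σ, a 0 h σ)
    fun h c => Finset.sum_congr rfl fun σ _ => htrans 0 h σ c] at htotal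
  have hprob := measureReal_map_prodMk_eq_sum (hx.prodMk hε) (hg.prodMk hπ) hindep
    (A := fun t => {p | countAbove (w t.1 p) t.2 0 < r}) fun t => hA 0 t.1 t.2
  rw [hlaw] at hprob
  simp only [real_pi_dirac_uniform_prod_uniform_singleton] at hprob
  have hsum : P.real {ω | countAbove (fun i => F (x ω, g ω i • ε ω)) (π ω) 0 < r} =
      (((Fintype.card G : ℝ) ^ (m - 1))⁻¹ * (m.factorial : ℝ)⁻¹) *
        ∑ h : Fin m → G, if h 0 = 1 then ∑ σ, a 0 h σ else 0 := by
    refine hprob.trans ?_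
    rw [Fintype.sum_prod_type, Finset.mul_sum]
    refine Finset.sum_congr rfl fun h _ => ?_
    split_ifs
    · rw [Finset.mul_sum]
      exact Finset.sum_congr rfl fun σ _ => by rw [one_mul]
    · simp
  have hm : (m : ℝ) ≠ 0 := Nat.cast_ne_zero.2 (NeZero.ne m)
  have hG : (Fintype.card G : ℝ) ≠ 0 := Nat.cast_ne_zero.2 Fintype.card_ne_zero
  have hfact : (m.factorial : ℝ) ≠ 0 := Nat.cast_ne_zero.2 m.factorial_ne_zero
  rw [hsum, eq_div_iff hm]
  rw [← pow_sub_one_mul (NeZero.ne m)] at htotal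
  field_simp
  apply mul_left_cancel₀ hG
  linear_combination htotal

/-- exact coverage of the gradient-perturbation confidence region:
with `0 < q < m`, a finite group `G` of measurable transformations of `ℝⁿ` leaving
the distribution of the noise `ε` invariant, inputs `x` independent of `ε`,
measurable `y*, α*` with `K(x)α* = y*`, observations `y = y* + ε`, transformations
`G_0 = id` and `G_1,…,G_{m−1}` i.i.d. uniform on `G` and a uniform random permutation
`π`, jointly independent of `(x, ε)` (encoded by the product law of `(g, π)`),
the reference and perturbed values
`Z_i = ‖Ψ(x) ḡ(x, α*, G_i(y − K(x)α*))‖²`, compared by the tie-broken order `≺_π`,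
give a normalized rank `R = (1 + #{i ≠ 0 : Z_0 ≺_π Z_i})/m` satisfying
`P(R ≤ 1 − q/m) = 1 − q/m`. -/
theorem gradient_perturbation_exact_coverage
    (n m q : ℕ) (hn : 1 ≤ n) (hq : 0 < q) (hqm : q < m) [NeZero m]
    (G : Type*) [Group G] [Fintype G]
    [MeasurableSpace G] [MeasurableSingletonClass G]
    [MulAction G (Fin n → ℝ)]
    (hact : ∀ c : G, Measurable (fun v : Fin n → ℝ => c • v))
    (𝒳 : Type*) [MeasurableSpace 𝒳]
    (Ω : Type*) [MeasurableSpace Ω] (P : Measure Ω) [IsProbabilityMeasure P]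
    (x : Ω → 𝒳) (hx : Measurable x)
    (ε : Ω → (Fin n → ℝ)) (hε : Measurable ε)
    (hxε : IndepFun x ε P)
    (hinv : ∀ c : G, Measure.map (fun ω => c • ε ω) P = Measure.map ε P)
    (ystar αstar : 𝒳 → (Fin n → ℝ))
    (hystar : Measurable ystar) (hαstar : Measurable αstar)
    (Kmat : 𝒳 → Matrix (Fin n) (Fin n) ℝ)
    (hKmat : Measurable (fun s => fun i j => Kmat s i j))
    (hKα : ∀ s : 𝒳, (Kmat s).mulVec (αstar s) = ystar s)
    (y : Ω → (Fin n → ℝ)) (hy : ∀ ω, y ω = ystar (x ω) + ε ω)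
    (gbar : 𝒳 × (Fin n → ℝ) × (Fin n → ℝ) → (Fin n → ℝ)) (hgbar : Measurable gbar)
    (Ψ : 𝒳 → Matrix (Fin n) (Fin n) ℝ)
    (hΨ : Measurable (fun s => fun i j => Ψ s i j))
    [MeasurableSpace (Equiv.Perm (Fin m))]
    [MeasurableSingletonClass (Equiv.Perm (Fin m))]
    (g : Ω → (Fin m → G)) (hgmeas : Measurable g)
    (hg0 : ∀ ω, g ω 0 = 1)
    (π : Ω → Equiv.Perm (Fin m)) (hπ : Measurable π)
    (hlaw : Measure.map (fun ω => (g ω, π ω)) P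
      = (Measure.pi (fun i : Fin m =>
          if i = 0 then Measure.dirac (1 : G)
          else (PMF.uniformOfFintype G).toMeasure)).prod
        (PMF.uniformOfFintype (Equiv.Perm (Fin m))).toMeasure)
    (hindep : IndepFun (fun ω => (x ω, ε ω)) (fun ω => (g ω, π ω)) P)
    (Z : Fin m → Ω → ℝ)
    (hZ : ∀ i ω, Z i ω = ∑ j, ((Ψ (x ω)).mulVec
      (gbar (x ω, αstar (x ω),
        g ω i • (y ω - (Kmat (x ω)).mulVec (αstar (x ω))))) j) ^ 2)
    (prec : Ω → Fin m → Fin m → Prop)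
    [∀ ω a b, Decidable (prec ω a b)]
    (hprec : ∀ ω k j, prec ω k j ↔
      (Z k ω < Z j ω ∨ (Z k ω = Z j ω ∧ π ω k < π ω j)))
    (R : Ω → ℝ)
    (hR : ∀ ω, R ω = (1 + ((Finset.univ.filter
      (fun i : Fin m => i ≠ 0 ∧ prec ω 0 i)).card : ℝ)) / m) :
    P {ω | R ω ≤ 1 - (q : ℝ) / m} = ENNReal.ofReal (1 - (q : ℝ) / m) := by
  have hm : (0 : ℝ) < m := Nat.cast_pos.2 (NeZero.pos m)
  let F : 𝒳 × (Fin n → ℝ) → ℝ := fun p =>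
    ∑ j, ((Ψ p.1).mulVec (gbar (p.1, αstar p.1, p.2)) j) ^ 2
  have hF : Measurable F := by
    refine Finset.measurable_fun_sum _ fun j _ => Measurable.pow_const ?_ 2
    simp only [Matrix.mulVec, dotProduct]
    have hgb : Measurable fun p : 𝒳 × (Fin n → ℝ) => gbar (p.1, αstar p.1, p.2) :=
      hgbar.comp (measurable_fst.prodMk ((hαstar.comp measurable_fst).prodMk measurable_snd))
    refine Finset.measurable_fun_sum _ fun l _ => Measurable.mul ?_ ?_
    · exact ((measurable_pi_apply l).comp ((measurable_pi_apply j).comp hΨ)).comp measurable_fst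
    · exact (measurable_pi_apply l).comp hgb
  have hZF : ∀ i ω, Z i ω = F (x ω, g ω i • ε ω) := by
    intro i ω
    rw [hZ, hy, hKα, add_sub_cancel_left]
  have hcount : ∀ ω, (Finset.univ.filter fun i : Fin m => i ≠ 0 ∧ prec ω 0 i).card =
      countAbove (fun i => F (x ω, g ω i • ε ω)) (π ω) 0 := by
    intro ω
    refine congrArg Finset.card (Finset.filter_congr fun i _ => ?_)
    simp only [hprec, hZF, and_iff_right_iff_imp]
    rintro h rfl
    simp at h
  have hevent : {ω | R ω ≤ 1 - (q : ℝ) / m} =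
      {ω | countAbove (fun i => F (x ω, g ω i • ε ω)) (π ω) 0 < m - q} := by
    ext ω
    rw [Set.mem_ofPred_eq, Set.mem_ofPred_eq, hR, hcount, one_sub_div hm.ne',
      div_le_div_iff_of_pos_right hm, ← Nat.cast_sub hqm.le]
    norm_cast
    omega
  rw [hevent, ← ofReal_measureReal, measureReal_countAbove_smul_lt hact hx hε hxε hinv hgmeas hπ
    hlaw hindep hF (Nat.sub_le m q), Nat.cast_sub hqm.le, one_sub_div hm.ne']
end

section
/- Let 𝒢 be a finite group (under composition) of measurable bijections of ℝⁿ, and let ε be an ℝⁿ-valued random vector such that G(ε) has the same distribution as ε for every G ∈ 𝒢. Let G_1,…,G_{m−1} be i.i.d. random transformations uniformly distributed on 𝒢, independent of ε. Then the finite sequence of ℝⁿ-valued random vectors (ε, G_1(ε), G_2(ε), …, G_{m−1}(ε)) is exchangeable: for every permutation σ of {0,1,…,m−1}, the permuted tuple has the same joint distribution as the original tuple (where the 0-th entry is ε itself). -/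
open MeasureTheory ProbabilityTheory

/-- The product of a Dirac mass at the identity (in coordinate `0`) with uniform distributions gives
the same mass to all tuples with `0`-th entry `1`, and no mass to the other tuples. -/
theorem exists_pi_dirac_uniform_singleton (m : ℕ) [NeZero m]
    (G : Type*) [Group G] [Fintype G] [DecidableEq G] [MeasurableSpace G]
    [MeasurableSingletonClass G] :
    ∃ k : ENNReal, ∀ h : Fin m → G, (Measure.pi (fun i : Fin m =>
        if i = 0 then Measure.dirac (1 : G) else (PMF.uniformOfFintype G).toMeasure)) {h}
      = if h 0 = 1 then k else 0 := by
  refine ⟨∏ i : Fin m, if i = 0 then 1 else (Fintype.card G : ENNReal)⁻¹, fun h => ?_⟩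
  have hfin : ∀ i : Fin m, IsProbabilityMeasure
      (if i = 0 then Measure.dirac (1 : G) else (PMF.uniformOfFintype G).toMeasure) := by
    intro i
    split_ifs <;> infer_instance
  rw [Measure.pi_singleton]
  split_ifs with h0
  · refine Finset.prod_congr rfl fun i _ => ?_
    split_ifs with hi
    · subst hi
      simp [h0]
    · rw [PMF.toMeasure_apply_singleton _ _ (measurableSet_singleton _),
        PMF.uniformOfFintype_apply]
  · refine Finset.prod_eq_zero (Finset.mem_univ 0) ?_
    simp [Ne.symm h0]

/-- Permuting a tuple of group elements and renormalizing its `0`-th entry to be `1` is a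
permutation of the tuples whose `0`-th entry is `1`. -/
theorem sum_comp_perm_renormalized {m : ℕ} [NeZero m] {G M : Type*} [Group G] [Fintype G]
    [DecidableEq G] [AddCommMonoid M] (σ : Equiv.Perm (Fin m)) (F : (Fin m → G) → M) :
    ∑ h : Fin m → G with h 0 = 1, F (fun i => h (σ i) * (h (σ 0))⁻¹)
      = ∑ h : Fin m → G with h 0 = 1, F h := by
  refine Finset.sum_nbij' (fun h i => h (σ i) * (h (σ 0))⁻¹)
    (fun h i => h (σ.symm i) * (h (σ.symm 0))⁻¹) ?_ ?_ ?_ ?_ ?_ <;>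
  simp +contextual

/-- The law of a tuple of random transformations applied to an independent random vector. -/
theorem map_smul_tuple_apply {ι G V Ω : Type*} [Fintype ι] [Group G] [Fintype G]
    [MeasurableSpace G] [MeasurableSingletonClass G] [MeasurableSpace V] [MulAction G V]
    (hact : ∀ c : G, Measurable (fun v : V => c • v))
    [MeasurableSpace Ω] {P : Measure Ω} [IsProbabilityMeasure P]
    {ε : Ω → V} (hε : Measurable ε) {g : Ω → (ι → G)} (hg : Measurable g)
    (hindep : IndepFun g ε P) (σ : Equiv.Perm ι) {A : Set (ι → V)} (hA : MeasurableSet A) :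
    Measure.map (fun ω => fun i => g ω (σ i) • ε ω) P A
      = ∫⁻ h, Measure.map ε P {v | (fun i => h (σ i) • v) ∈ A} ∂(Measure.map g P) := by
  have hΦ : Measurable (fun p : (ι → G) × V => fun i => p.1 (σ i) • p.2) :=
    measurable_from_prod_countable_right fun h => measurable_pi_lambda _ fun i => hact (h (σ i))
  have hprod := (indepFun_iff_map_prod_eq_prod_map_map hg.aemeasurable hε.aemeasurable).1 hindep
  have : IsProbabilityMeasure (Measure.map ε P) :=
    Measure.isProbabilityMeasure_map hε.aemeasurable
  have hcomp : (fun ω => fun i => g ω (σ i) • ε ω)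
      = (fun p : (ι → G) × V => fun i => p.1 (σ i) • p.2) ∘ fun ω => (g ω, ε ω) := rfl
  rw [hcomp, ← Measure.map_map hΦ (hg.prodMk hε), hprod, Measure.map_apply hΦ hA,
    Measure.prod_apply (hΦ hA)]
  rfl

/-- if `ε` is distributionally invariant under a finite group `G` of
measurable transformations of `ℝⁿ`, and `G_1,…,G_{m−1}` are i.i.d. uniform on `G`
and independent of `ε` (encoded as a random vector `g : Ω → (Fin m → G)` whose
`0`-th coordinate is the identity and whose distribution is the product of a Dirac
at the identity and uniform distributions), then the tuple
`(ε, G_1(ε), …, G_{m−1}(ε))`, i.e. `i ↦ g_i(ε)`, is exchangeable. -/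
theorem reference_and_perturbed_noises_exchangeable
    (n m : ℕ) [NeZero m]
    (G : Type*) [Group G] [Fintype G]
    [MeasurableSpace G] [MeasurableSingletonClass G]
    [MulAction G (Fin n → ℝ)]
    (hact : ∀ c : G, Measurable (fun v : Fin n → ℝ => c • v))
    (Ω : Type*) [MeasurableSpace Ω] (P : Measure Ω) [IsProbabilityMeasure P]
    (ε : Ω → (Fin n → ℝ)) (hε : Measurable ε)
    (hinv : ∀ c : G, Measure.map (fun ω => c • ε ω) P = Measure.map ε P)
    (g : Ω → (Fin m → G)) (hgmeas : Measurable g)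
    (hg0 : ∀ ω, g ω 0 = 1)
    (hglaw : Measure.map g P
      = Measure.pi (fun i : Fin m =>
          if i = 0 then Measure.dirac (1 : G) else (PMF.uniformOfFintype G).toMeasure))
    (hindep : IndepFun g ε P) :
    ∀ σ : Equiv.Perm (Fin m),
      Measure.map (fun ω => fun i : Fin m => g ω (σ i) • ε ω) P
        = Measure.map (fun ω => fun i : Fin m => g ω i • ε ω) P := by
  classical
  intro σ
  obtain ⟨k, hk⟩ := exists_pi_dirac_uniform_singleton m G
  have hΦ : ∀ h : Fin m → G, Measurable (fun v : Fin n → ℝ => fun i => h i • v) :=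
    fun h => measurable_pi_lambda _ fun i => hact (h i)
  ext A hA
  let F : (Fin m → G) → ENNReal := fun h => Measure.map ε P {v | (fun i => h i • v) ∈ A}
  have hF : ∀ (h : Fin m → G) (c : G), F (fun i => h i * c) = F h := by
    intro h c
    have hmap : Measure.map (fun v => c • v) (Measure.map ε P) = Measure.map ε P := by
      rw [Measure.map_map (hact c) hε]
      exact hinv c
    have happly := Measure.map_apply (μ := Measure.map ε P) (hact c) (hΦ h hA)
    rw [hmap] at happly
    simp only [F, mul_smul]
    exact happly.symm
  have hlaw : ∀ τ : Equiv.Perm (Fin m),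
      Measure.map (fun ω => fun i : Fin m => g ω (τ i) • ε ω) P A
        = ∑ h : Fin m → G with h 0 = 1, F h * k := by
    intro τ
    rw [map_smul_tuple_apply hact hε hgmeas hindep τ hA, lintegral_fintype, hglaw,
      ← sum_comp_perm_renormalized τ (fun h => F h * k),
      Finset.sum_filter]
    refine Finset.sum_congr rfl fun h _ => ?_
    rw [hk, hF (fun i => h (τ i)), mul_ite, mul_zero]
  exact (hlaw σ).trans (hlaw 1).symm
end

section
/- Let Z_0, Z_1, …, Z_{m−1} be real-valued random variables whose joint distribution is exchangeable, and let π be a uniformly distributed random permutation of {0,…,m−1}, independent of (Z_0,…,Z_{m−1}). Define the random strict total order ≺_π by Z_k ≺_π Z_j iff Z_k < Z_j, or Z_k = Z_j and π(k) < π(j). Then Z_0,…,Z_{m−1} are uniformly ordered: for every fixed permutation (i_0, i_1, …, i_{m−1}) of (0, 1, …, m−1), P( Z_{i_0} ≺_π Z_{i_1} ≺_π ⋯ ≺_π Z_{i_{m−1}} ) = 1/m!. -/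
open MeasureTheory ProbabilityTheory

/-- The values `z i` paired lexicographically with the tie-breaking ranks `p i`. -/
def tieBrokenKey {m : ℕ} (x : (Fin m → ℝ) × Equiv.Perm (Fin m)) (i : Fin m) : ℝ ×ₗ Fin m :=
  toLex (x.1 i, x.2 i)

/-- The configurations for which `τ` lists the indices in increasing tie-broken order. -/
def orderedBy {m : ℕ} (τ : Equiv.Perm (Fin m)) : Set ((Fin m → ℝ) × Equiv.Perm (Fin m)) :=
  {x | StrictMono (tieBrokenKey x ∘ τ)}

lemma mem_orderedBy_iff {m : ℕ} {τ : Equiv.Perm (Fin m)}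
    {x : (Fin m → ℝ) × Equiv.Perm (Fin m)} :
    x ∈ orderedBy τ ↔ ∀ j k : Fin m, j < k →
      x.1 (τ j) < x.1 (τ k) ∨ (x.1 (τ j) = x.1 (τ k) ∧ x.2 (τ j) < x.2 (τ k)) := by
  simp only [orderedBy, StrictMono, Set.mem_ofPred_eq, Function.comp_apply, tieBrokenKey,
    Prod.Lex.toLex_lt_toLex]

lemma tieBrokenKey_injective {m : ℕ} (x : (Fin m → ℝ) × Equiv.Perm (Fin m)) :
    Function.Injective (tieBrokenKey x) := by
  intro i j h
  exact x.2.injective (congrArg (fun y => (ofLex y).2) h)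

lemma iUnion_orderedBy (m : ℕ) :
    ⋃ τ : Equiv.Perm (Fin m), orderedBy τ = Set.univ := by
  refine Set.eq_univ_of_forall fun x => Set.mem_iUnion.2 ⟨Tuple.sort (tieBrokenKey x), ?_⟩
  exact (Tuple.monotone_sort _).strictMono_of_injective
    ((tieBrokenKey_injective x).comp (Equiv.injective _))

lemma pairwise_disjoint_orderedBy (m : ℕ) :
    Pairwise (Function.onFun Disjoint (orderedBy (m := m))) := by
  intro σ τ hne
  refine Set.disjoint_left.2 fun x hσ hτ => hne ?_
  have h := Tuple.unique_monotone (StrictMono.monotone hσ) (StrictMono.monotone hτ)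
  exact Equiv.ext fun i => tieBrokenKey_injective x (congrFun h i)

lemma measurableSet_orderedBy {m : ℕ} [MeasurableSpace (Equiv.Perm (Fin m))]
    [MeasurableSingletonClass (Equiv.Perm (Fin m))] (τ : Equiv.Perm (Fin m)) :
    MeasurableSet (orderedBy τ) := by
  have hrank (i j : Fin m) :
      MeasurableSet {x : (Fin m → ℝ) × Equiv.Perm (Fin m) | x.2 i < x.2 j} :=
    measurable_snd (Set.toFinite {p : Equiv.Perm (Fin m) | p i < p j}).measurableSet
  have hval (i : Fin m) :
      Measurable fun x : (Fin m → ℝ) × Equiv.Perm (Fin m) => x.1 i :=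
    (measurable_pi_apply i).comp measurable_fst
  have h : orderedBy τ = ⋂ (j : Fin m) (k : Fin m) (_ : j < k),
      ({x | x.1 (τ j) < x.1 (τ k)} ∪
        ({x | x.1 (τ j) = x.1 (τ k)} ∩ {x | x.2 (τ j) < x.2 (τ k)})) := by
    ext x
    simp [mem_orderedBy_iff]
  rw [h]
  exact MeasurableSet.iInter fun j => MeasurableSet.iInter fun k => MeasurableSet.iInter fun _ =>
    (measurableSet_lt (hval _) (hval _)).union
      ((measurableSet_eq_fun (hval _) (hval _)).inter (hrank _ _))

/-- The uniform distribution on a finite group is invariant under right translation. -/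
lemma map_mul_right_uniformOfFintype {G : Type*} [Group G] [Fintype G]
    [MeasurableSpace G] [MeasurableSingletonClass G] (g : G) :
    Measure.map (· * g) (PMF.uniformOfFintype G).toMeasure
      = (PMF.uniformOfFintype G).toMeasure := by
  refine Measure.ext_of_singleton fun a => ?_
  have hpre : (· * g) ⁻¹' {a} = {a * g⁻¹} := by
    ext b
    simp [eq_mul_inv_iff_mul_eq]
  rw [Measure.map_apply (measurable_of_finite _) (measurableSet_singleton a), hpre,
    PMF.toMeasure_apply_singleton _ _ (measurableSet_singleton _),
    PMF.toMeasure_apply_singleton _ _ (measurableSet_singleton _)]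
  simp

/-- Under a law that is exchangeable in the values and uniform in the ranks, all orderings are
equally likely. -/
lemma prod_uniformOfFintype_orderedBy {m : ℕ} [MeasurableSpace (Equiv.Perm (Fin m))]
    [MeasurableSingletonClass (Equiv.Perm (Fin m))] (μ : Measure (Fin m → ℝ))
    [IsProbabilityMeasure μ]
    (hμ : ∀ σ : Equiv.Perm (Fin m), Measure.map (fun z i => z (σ i)) μ = μ)
    (τ : Equiv.Perm (Fin m)) :
    (μ.prod (PMF.uniformOfFintype (Equiv.Perm (Fin m))).toMeasure) (orderedBy τ)
      = ((Nat.factorial m : ENNReal))⁻¹ := by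
  set ν := (PMF.uniformOfFintype (Equiv.Perm (Fin m))).toMeasure
  have hperm (σ : Equiv.Perm (Fin m)) :
      (μ.prod ν) (orderedBy σ) = (μ.prod ν) (orderedBy 1) := by
    have hz : Measurable fun (z : Fin m → ℝ) i => z (σ i) := by fun_prop
    have hp : Measurable fun p : Equiv.Perm (Fin m) => p * σ := measurable_of_finite _
    have hinv : Measure.map (Prod.map (fun z i => z (σ i)) (· * σ)) (μ.prod ν) = μ.prod ν := by
      rw [← Measure.map_prod_map μ ν hz hp, hμ, map_mul_right_uniformOfFintype]
    conv_rhs => rw [← hinv]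
    rw [Measure.map_apply (hz.prodMap hp) (measurableSet_orderedBy 1)]
    rfl
  have hsum : ∑ σ : Equiv.Perm (Fin m), (μ.prod ν) (orderedBy σ) = 1 := by
    rw [← tsum_fintype (L := .unconditional _), ← measure_iUnion (pairwise_disjoint_orderedBy m)
      measurableSet_orderedBy, iUnion_orderedBy, measure_univ]
  simp only [hperm, Finset.sum_const, Finset.card_univ, Fintype.card_perm, Fintype.card_fin,
    nsmul_eq_mul] at hsum
  rw [hperm]
  exact ENNReal.eq_inv_of_mul_eq_one_left (by rwa [mul_comm])

/-- if `Z_0,…,Z_{m−1}` are real random variables with exchangeable joint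
distribution, and `π` is a uniformly random permutation of `{0,…,m−1}` independent of
`(Z_0,…,Z_{m−1})`, then with respect to the tie-broken strict order
`Z_k ≺_π Z_j ↔ Z_k < Z_j ∨ (Z_k = Z_j ∧ π k < π j)`, every fixed ordering
`Z_{i_0} ≺_π ⋯ ≺_π Z_{i_{m−1}}` has probability exactly `1/m!`. -/
theorem exchangeable_variables_uniformly_ordered
    (m : ℕ)
    (Ω : Type*) [MeasurableSpace Ω] (P : Measure Ω) [IsProbabilityMeasure P]
    (Z : Fin m → Ω → ℝ) (hZ : ∀ i, Measurable (Z i))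
    (hexch : ∀ σ : Equiv.Perm (Fin m),
      Measure.map (fun ω => fun i => Z (σ i) ω) P
        = Measure.map (fun ω => fun i => Z i ω) P)
    [MeasurableSpace (Equiv.Perm (Fin m))]
    [MeasurableSingletonClass (Equiv.Perm (Fin m))]
    (π : Ω → Equiv.Perm (Fin m)) (hπ : Measurable π)
    (hπunif : Measure.map π P = (PMF.uniformOfFintype (Equiv.Perm (Fin m))).toMeasure)
    (hindep : IndepFun (fun ω => fun i => Z i ω) π P)
    (prec : Ω → Fin m → Fin m → Prop)
    (hprec : ∀ ω k j, prec ω k j ↔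
      (Z k ω < Z j ω ∨ (Z k ω = Z j ω ∧ π ω k < π ω j))) :
    ∀ τ : Equiv.Perm (Fin m),
      P {ω | ∀ j k : Fin m, j < k → prec ω (τ j) (τ k)}
        = ((Nat.factorial m : ENNReal))⁻¹ := by
  intro τ
  have hZm : Measurable fun ω i => Z i ω := measurable_pi_lambda _ hZ
  have : IsProbabilityMeasure (Measure.map (fun ω i => Z i ω) P) :=
    Measure.isProbabilityMeasure_map hZm.aemeasurable
  have hlaw := (indepFun_iff_map_prod_eq_prod_map_map hZm.aemeasurable hπ.aemeasurable).1 hindep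
  have hinv (σ : Equiv.Perm (Fin m)) :
      Measure.map (fun z i => z (σ i)) (Measure.map (fun ω i => Z i ω) P)
        = Measure.map (fun ω i => Z i ω) P := by
    rw [Measure.map_map (by fun_prop) hZm]
    exact hexch σ
  have hset : {ω | ∀ j k : Fin m, j < k → prec ω (τ j) (τ k)}
      = (fun ω => ((fun i => Z i ω), π ω)) ⁻¹' orderedBy τ := by
    ext ω
    simp only [Set.mem_ofPred_eq, hprec, Set.mem_preimage, mem_orderedBy_iff]
  rw [hset, ← Measure.map_apply (hZm.prodMk hπ) (measurableSet_orderedBy τ), hlaw, hπunif]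
  exact prod_uniformOfFintype_orderedBy _ hinv τ
end
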